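/- Let Δ ⊂ ℝ^d be a lattice simplex of dimension d with vertices v_1, …, v_{d+1} ∈ ℤ^d and let k ≥ 3 be an integer. Assume that no α ∈ Λ_Δ satisfies k+1 ≤ ht(α) ≤ 2k, and let Λ' = { α ∈ Λ_Δ : ht(α) ≤ k }. Then #supp(Λ') ≤ 4k − 1, where supp(Λ') = ⋃_{α ∈ Λ'} supp(α). -/

import Mathlib

open scoped Pointwise

/-- The coercion of an integer point to a real point. -/
def toReal {d : ℕ} (x : Fin d → ℤ) : Fin d → ℝ := fun i => (x i : ℝ)

/-- The number of lattice points in the `n`-th dilation of `P ⊆ ℝ^d`. -/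
noncomputable def latticeCount {d : ℕ} (P : Set (Fin d → ℝ)) (n : ℕ) : ℕ :=
  Set.ncard {x : Fin d → ℤ | toReal x ∈ (n : ℝ) • P}

/-- The finite abelian group `Λ_Δ` attached to a lattice simplex with vertices `v`. -/
def Lambda {d : ℕ} (v : Fin (d + 1) → Fin d → ℤ) : Set (Fin (d + 1) → ℝ) :=
  {r | (∀ j, 0 ≤ r j ∧ r j < 1) ∧
    (∀ i : Fin d, ∃ z : ℤ, ∑ j, r j * (v j i : ℝ) = (z : ℝ)) ∧
    (∃ z : ℤ, ∑ j, r j = (z : ℝ))}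

/-- The height `ht(α) = ∑ᵢ αᵢ`. -/
def ht {m : ℕ} (α : Fin m → ℝ) : ℝ := ∑ i, α i

/-- The support `supp(α) = {i : αᵢ > 0}`. -/
def suppOf {m : ℕ} (α : Fin m → ℝ) : Set (Fin m) := {i | 0 < α i}

/-- Addition on `Λ_Δ`: coordinatewise fractional part of the sum. -/
noncomputable def fadd {m : ℕ} (α β : Fin m → ℝ) : Fin m → ℝ := fun i => Int.fract (α i + β i)

/-- Negation on `Λ_Δ`: coordinatewise fractional part of `1 - αᵢ`. -/
noncomputable def fneg {m : ℕ} (α : Fin m → ℝ) : Fin m → ℝ := fun i => Int.fract (1 - α i)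

/-- `P ⊆ ℝ^d` is a lattice polytope of dimension `d`: the convex hull of a finite
set of lattice points whose affine span is all of `ℝ^d`. -/
def IsFullDimLatticePolytope {d : ℕ} (P : Set (Fin d → ℝ)) : Prop :=
  ∃ V : Finset (Fin d → ℤ),
    P = convexHull ℝ (toReal '' (V : Set (Fin d → ℤ))) ∧ affineSpan ℝ P = ⊤

theorem finite_Lambda {d : ℕ} (v : Fin (d + 1) → Fin d → ℤ)
    (hv : AffineIndependent ℝ (fun j => toReal (v j))) : (Lambda v).Finite := by
  let φ : (Fin (d + 1) → ℝ) → (Fin d → ℤ) × ℤ := fun r =>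
    (fun i => ⌊∑ j, r j * (v j i : ℝ)⌋, ⌊∑ j, r j⌋)
  let B : Fin d → ℤ := fun i => ∑ j, |v j i|
  have hmaps : Set.MapsTo φ (Lambda v) (Set.Icc (-B) B ×ˢ Set.Icc 0 ((d : ℤ) + 1)) := by
    rintro r ⟨h01, hz, z, hzs⟩
    have habs : ∀ i, |∑ j, r j * (v j i : ℝ)| ≤ (B i : ℝ) := fun i => by
      simp only [B, Int.cast_sum, Int.cast_abs]
      refine (Finset.abs_sum_le_sum_abs _ _).trans (Finset.sum_le_sum fun j _ => ?_)
      rw [abs_mul, abs_of_nonneg (h01 j).1]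
      exact mul_le_of_le_one_left (abs_nonneg _) (h01 j).2.le
    have hcoord : ∀ i, -B i ≤ (φ r).1 i ∧ (φ r).1 i ≤ B i := fun i => by
      obtain ⟨w, hw⟩ := hz i
      have h := abs_le.1 (habs i)
      simp only [φ]
      rw [hw] at h ⊢
      rw [Int.floor_intCast]
      exact_mod_cast h
    refine ⟨⟨fun i => (hcoord i).1, fun i => (hcoord i).2⟩, ?_, ?_⟩
    · exact Int.floor_nonneg.2 (Finset.sum_nonneg fun j _ => (h01 j).1)
    · have hle : ∑ j, r j ≤ ∑ _j : Fin (d + 1), (1 : ℝ) :=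
        Finset.sum_le_sum fun j _ => (h01 j).2.le
      simp only [φ]
      rw [hzs] at hle ⊢
      rw [Int.floor_intCast]
      simp only [Finset.sum_const, Finset.card_univ, Fintype.card_fin, nsmul_eq_mul,
        mul_one] at hle
      exact_mod_cast hle
  have hinj : Set.InjOn φ (Lambda v) := by
    rintro r ⟨-, hr, z, hz⟩ s ⟨-, hs, w, hw⟩ heq
    have h1 : ∀ i, ∑ j, r j * (v j i : ℝ) = ∑ j, s j * (v j i : ℝ) := fun i => by
      have := congrFun (congrArg Prod.fst heq) i
      obtain ⟨a, ha⟩ := hr i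
      obtain ⟨b, hb⟩ := hs i
      simp only [φ, ha, hb, Int.floor_intCast] at this
      rw [ha, hb, this]
    have h2 : ∑ j, r j = ∑ j, s j := by
      have := congrArg Prod.snd heq
      simp only [φ, hz, hw, Int.floor_intCast] at this
      rw [hz, hw, this]
    funext j
    refine sub_eq_zero.1 (affineIndependent_iff.1 hv Finset.univ (fun j => r j - s j)
      (by rw [Finset.sum_sub_distrib, h2, sub_self]) ?_ j (Finset.mem_univ j))
    funext i
    simp only [Finset.sum_apply, Pi.smul_apply, smul_eq_mul, toReal, sub_mul,
      Finset.sum_sub_distrib, h1, sub_self, Pi.zero_apply]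
  exact Set.Finite.of_injOn hmaps hinj ((Set.finite_Icc _ _).prod (Set.finite_Icc _ _))

theorem zero_mem_Lambda {d : ℕ} (v : Fin (d + 1) → Fin d → ℤ) : 0 ∈ Lambda v :=
  ⟨by simp, fun _ => ⟨0, by simp⟩, 0, by simp⟩

theorem fadd_mem_Lambda {d : ℕ} {v : Fin (d + 1) → Fin d → ℤ} {α β : Fin (d + 1) → ℝ}
    (hα : α ∈ Lambda v) (hβ : β ∈ Lambda v) : fadd α β ∈ Lambda v := by
  obtain ⟨-, hα1, a, ha⟩ := hα
  obtain ⟨-, hβ1, b, hb⟩ := hβ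
  refine ⟨fun j => ⟨Int.fract_nonneg _, Int.fract_lt_one _⟩, fun i => ?_, ?_⟩
  · obtain ⟨x, hx⟩ := hα1 i
    obtain ⟨y, hy⟩ := hβ1 i
    refine ⟨x + y - ∑ j, ⌊α j + β j⌋ * v j i, ?_⟩
    push_cast
    rw [← hx, ← hy, ← Finset.sum_add_distrib, ← Finset.sum_sub_distrib]
    refine Finset.sum_congr rfl fun j _ => ?_
    rw [fadd, Int.fract]
    ring
  · refine ⟨a + b - ∑ j, ⌊α j + β j⌋, ?_⟩
    push_cast
    rw [← ha, ← hb, ← Finset.sum_add_distrib, ← Finset.sum_sub_distrib]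
    rfl

theorem ht_fadd_le {m : ℕ} {α β : Fin m → ℝ} (hα : ∀ i, 0 ≤ α i) (hβ : ∀ i, 0 ≤ β i) :
    ht (fadd α β) ≤ ht α + ht β := by
  rw [ht, ht, ht, ← Finset.sum_add_distrib]
  refine Finset.sum_le_sum fun i _ => ?_
  have : (0 : ℝ) ≤ ⌊α i + β i⌋ := by
    exact_mod_cast Int.floor_nonneg.2 (add_nonneg (hα i) (hβ i))
  rw [fadd, Int.fract]
  linarith

theorem fadd_left_injOn {m : ℕ} (β : Fin m → ℝ) :
    Set.InjOn (fadd β) {α | ∀ i, 0 ≤ α i ∧ α i < 1} := by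
  intro α hα γ hγ h
  funext i
  obtain ⟨z, hz⟩ := Int.fract_eq_fract.1 (congrFun h i)
  have hz' : α i - γ i = z := by linarith
  rw [← Int.fract_eq_self.2 (hα i), ← Int.fract_eq_self.2 (hγ i)]
  exact Int.fract_eq_fract.2 ⟨z, hz'⟩

theorem add_eq_one_of_fract_add_eq_zero {x y : ℝ} (hx : 0 < x) (hx1 : x < 1) (hy : 0 ≤ y)
    (hy1 : y < 1) (h : Int.fract (x + y) = 0) : x + y = 1 := by
  obtain ⟨z, hz⟩ := Int.fract_eq_zero_iff.1 h
  have h0 : (0 : ℝ) < z := by linarith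
  have h2 : (z : ℝ) < 2 := by linarith
  have hz1 : z = 1 := by
    have : 0 < z := by exact_mod_cast h0
    have : z < 2 := by exact_mod_cast h2
    omega
  rw [← hz, hz1, Int.cast_one]

/-- In a finite subgroup of the torus, a coordinate that does not vanish identically has
average at least `1 / 4`. -/
theorem card_le_four_mul_sum_coord {m : ℕ} {S : Finset (Fin m → ℝ)}
    (h01 : ∀ α ∈ S, ∀ i, 0 ≤ α i ∧ α i < 1) (h0 : 0 ∈ S)
    (hadd : ∀ α ∈ S, ∀ β ∈ S, fadd α β ∈ S) {i : Fin m} {β : Fin m → ℝ} (hβ : β ∈ S)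
    (hβi : 0 < β i) : (S.card : ℝ) ≤ 4 * ∑ α ∈ S, α i := by
  classical
  have hinj : ∀ γ, Set.InjOn (fadd γ) S := fun γ =>
    (fadd_left_injOn γ).mono fun α hα => h01 α hα
  have hneg : ∀ α ∈ S, ∃ γ ∈ S, fadd α γ = 0 := fun α hα =>
    Finset.surjOn_of_injOn_of_card_le (fadd α) (fun γ hγ => hadd α hα γ hγ) (hinj α) le_rfl h0
  choose! N hN hN0 using hneg
  have hcomm : ∀ α γ : Fin m → ℝ, fadd α γ = fadd γ α := fun α γ => by
    funext j
    rw [fadd, fadd, add_comm]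
  have hNN : ∀ α ∈ S, N (N α) = α := fun α hα =>
    hinj (N α) (hN _ (hN α hα)) hα (by rw [hN0 _ (hN α hα), hcomm, hN0 α hα])
  have hsum : ∑ α ∈ S, N α i = ∑ α ∈ S, α i :=
    Finset.sum_nbij' N N hN hN hNN hNN fun _ _ => rfl
  have hpos : ((S.filter fun α => 0 < α i).card : ℝ) ≤ ∑ α ∈ S, (α i + N α i) := by
    rw [Finset.card_filter, Nat.cast_sum]
    refine Finset.sum_le_sum fun α hα => ?_
    have hα1 := h01 α hα i
    have hN1 := h01 _ (hN α hα) i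
    split_ifs with h
    · rw [add_eq_one_of_fract_add_eq_zero h hα1.2 hN1.1 hN1.2 (congrFun (hN0 α hα) i)]
      simp
    · simpa using add_nonneg hα1.1 hN1.1
  have hle : (S.filter fun α => ¬ 0 < α i).card ≤ (S.filter fun α => 0 < α i).card := by
    refine Finset.card_le_card_of_injOn (fadd β) (fun α hα => ?_)
      ((hinj β).mono fun α hα => (Finset.mem_filter.1 hα).1)
    obtain ⟨hαS, hαi⟩ := Finset.mem_filter.1 hα
    have hz : α i = 0 := le_antisymm (not_lt.1 hαi) (h01 α hαS i).1
    refine Finset.mem_filter.2 ⟨hadd β hβ α hαS, ?_⟩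
    rwa [fadd, hz, add_zero, Int.fract_eq_self.2 (h01 β hβ i)]
  have hcard := Finset.card_filter_add_card_filter_not (s := S) (fun α => 0 < α i)
  have h2 : (S.card : ℝ) ≤ 2 * (S.filter fun α => 0 < α i).card := by
    exact_mod_cast (by omega : S.card ≤ 2 * (S.filter fun α => 0 < α i).card)
  rw [Finset.sum_add_distrib, hsum] at hpos
  linarith

/-- A finite subgroup of the torus all of whose elements have height at most `k > 0` has
support of size less than `4 * k`. -/
theorem ncard_iUnion_suppOf_lt {m k : ℕ} (hk : 0 < k) {S : Finset (Fin m → ℝ)}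
    (h01 : ∀ α ∈ S, ∀ i, 0 ≤ α i ∧ α i < 1) (h0 : 0 ∈ S)
    (hadd : ∀ α ∈ S, ∀ β ∈ S, fadd α β ∈ S) (hht : ∀ α ∈ S, ht α ≤ k) :
    (⋃ α ∈ S, suppOf α).ncard < 4 * k := by
  classical
  set U : Finset (Fin m) := (⋃ α ∈ S, suppOf α).toFinset with hU
  rw [Set.ncard_eq_toFinset_card', ← hU]
  have hlow : (U.card : ℝ) * S.card ≤ 4 * ∑ i ∈ U, ∑ α ∈ S, α i := by
    rw [Finset.mul_sum, ← nsmul_eq_mul]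
    refine Finset.card_nsmul_le_sum _ _ _ fun i hi => ?_
    obtain ⟨β, hβ, hβi⟩ := Set.mem_iUnion₂.1 (Set.mem_toFinset.1 hi)
    exact card_le_four_mul_sum_coord h01 h0 hadd hβ hβi
  have hup : ∑ i ∈ U, ∑ α ∈ S, α i ≤ ∑ α ∈ S, ht α := by
    rw [Finset.sum_comm]
    exact Finset.sum_le_sum fun α hα =>
      Finset.sum_le_univ_sum_of_nonneg fun i => (h01 α hα i).1
  have hlt : ∑ α ∈ S, ht α < ∑ _α ∈ S, (k : ℝ) :=
    Finset.sum_lt_sum hht ⟨0, h0, by simpa [ht] using hk⟩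
  rw [Finset.sum_const, nsmul_eq_mul] at hlt
  have hS : (0 : ℝ) < S.card := by exact_mod_cast Finset.card_pos.2 ⟨0, h0⟩
  have : (U.card : ℝ) < 4 * k := lt_of_mul_lt_mul_right (by linarith) hS.le
  exact_mod_cast this

/-- if no `α ∈ Λ_Δ` has `k+1 ≤ ht(α) ≤ 2k`, then the support of
`Λ' = {α ∈ Λ_Δ : ht(α) ≤ k}` has at most `4k - 1` elements. -/
theorem stmt5 (d k : ℕ) (hk : 3 ≤ k) (v : Fin (d + 1) → Fin d → ℤ)
    (hv : AffineIndependent ℝ (fun j => toReal (v j)))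
    (hvanish : ∀ α ∈ Lambda v, ¬((k : ℝ) + 1 ≤ ht α ∧ ht α ≤ 2 * (k : ℝ))) :
    Set.ncard (⋃ α ∈ {α | α ∈ Lambda v ∧ ht α ≤ (k : ℝ)}, suppOf α) ≤ 4 * k - 1 := by
  have hfin : {α | α ∈ Lambda v ∧ ht α ≤ (k : ℝ)}.Finite :=
    (finite_Lambda v hv).subset fun α hα => hα.1
  have hlt := ncard_iUnion_suppOf_lt (k := k) (by omega) (S := hfin.toFinset)
    (fun α hα => ((hfin.mem_toFinset.1 hα).1).1)
    (hfin.mem_toFinset.2 ⟨zero_mem_Lambda v, by simp [ht]⟩)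
    (fun α hα β hβ => ?_) (fun α hα => (hfin.mem_toFinset.1 hα).2)
  · simp only [hfin.mem_toFinset] at hlt
    omega
  · obtain ⟨hα, hαk⟩ := hfin.mem_toFinset.1 hα
    obtain ⟨hβ, hβk⟩ := hfin.mem_toFinset.1 hβ
    have hmem := fadd_mem_Lambda hα hβ
    refine hfin.mem_toFinset.2 ⟨hmem, ?_⟩
    have hle := ht_fadd_le (fun i => (hα.1 i).1) (fun i => (hβ.1 i).1)
    have hnot : ¬ (k : ℝ) + 1 ≤ ht (fadd α β) := fun h =>
      hvanish _ hmem ⟨h, by linarith⟩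
    obtain ⟨z, hz⟩ := hmem.2.2
    rw [ht, hz] at hnot ⊢
    have hz' : ¬ (k : ℤ) + 1 ≤ z := by exact_mod_cast hnot
    exact_mod_cast (by omega : z ≤ (k : ℤ))
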